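/- There exists a constant C > 0 such that for all f₁, f₂ in the class below, ‖f₁ f₂‖_{H³} ≤ C ( ‖f₁‖_{H³} ‖f₂‖_{H²} + ‖f₁‖_{H¹} ‖f₂‖_{H⁴} ). The constant C is independent of f₁, f₂. -/

import Mathlib

open MeasureTheory

noncomputable section

/-- Partial derivative in the first variable `x`. -/
def pdx (f : ℝ → ℝ → ℝ → ℂ) : ℝ → ℝ → ℝ → ℂ :=
  fun x y z => deriv (fun x' => f x' y z) x

/-- Partial derivative in the second variable `y`. -/
def pdy (f : ℝ → ℝ → ℝ → ℂ) : ℝ → ℝ → ℝ → ℂ :=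
  fun x y z => deriv (fun y' => f x y' z) y

/-- Partial derivative in the third variable `z`. -/
def pdz (f : ℝ → ℝ → ℝ → ℂ) : ℝ → ℝ → ℝ → ℂ :=
  fun x y z => deriv (fun z' => f x y z') z

/-- Iterated partial derivative `∂^α` for a multi-index `α ∈ ℕ³`. -/
def pderiv3 (α : ℕ × ℕ × ℕ) (f : ℝ → ℝ → ℝ → ℂ) : ℝ → ℝ → ℝ → ℂ :=
  (pdx^[α.1]) ((pdy^[α.2.1]) ((pdz^[α.2.2]) f))

/-- Squared `L²` norm on `Ω = 𝕋 × ℝ × 𝕋` (with periods `1` in `x` and `z`):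
`‖f‖_{L²}² = ∫₀¹∫_ℝ∫₀¹ |f(x,y,z)|² dx dy dz`. -/
def L2sq (f : ℝ → ℝ → ℝ → ℂ) : ℝ :=
  ∫ x in Set.Ioc (0:ℝ) 1, ∫ y : ℝ, ∫ z in Set.Ioc (0:ℝ) 1, ‖f x y z‖ ^ 2

/-- `L²` norm on `Ω = 𝕋 × ℝ × 𝕋`. -/
def L2norm (f : ℝ → ℝ → ℝ → ℂ) : ℝ :=
  Real.sqrt (L2sq f)

/-- The multi-indices `α ∈ ℕ³` of order `|α| ≤ N`. -/
def multiIndicesLe (N : ℕ) : Finset (ℕ × ℕ × ℕ) :=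
  (Finset.range (N+1) ×ˢ Finset.range (N+1) ×ˢ Finset.range (N+1)).filter
    fun α => α.1 + α.2.1 + α.2.2 ≤ N

/-- Squared `H^N` norm: `‖f‖_{H^N}² = Σ_{|α| ≤ N} ‖∂^α f‖_{L²}²`. -/
def HNsq (N : ℕ) (f : ℝ → ℝ → ℝ → ℂ) : ℝ :=
  ∑ α ∈ multiIndicesLe N, L2sq (pderiv3 α f)

/-- `H^N` norm. -/
def HN (N : ℕ) (f : ℝ → ℝ → ℝ → ℂ) : ℝ :=
  Real.sqrt (HNsq N f)

/-- `L²` norm of the gradient: `‖∇f‖_{L²}² = ‖∂_x f‖² + ‖∂_y f‖² + ‖∂_z f‖²`. -/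
def gradL2norm (f : ℝ → ℝ → ℝ → ℂ) : ℝ :=
  Real.sqrt (L2sq (pdx f) + L2sq (pdy f) + L2sq (pdz f))

/-- The Laplacian `Δ = ∂_x² + ∂_y² + ∂_z²`. -/
def lap (f : ℝ → ℝ → ℝ → ℂ) : ℝ → ℝ → ℝ → ℂ :=
  pdx (pdx f) + pdy (pdy f) + pdz (pdz f)

/-- The operator `∂_x² + ∂_z²`. -/
def dxxzz (f : ℝ → ℝ → ℝ → ℂ) : ℝ → ℝ → ℝ → ℂ :=
  pdx (pdx f) + pdz (pdz f)

/-- The class of smooth functions `f : ℝ³ → ℂ` which are `1`-periodic in `x` and in `z`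
and, together with all partial derivatives, decay faster than any polynomial as
`|y| → ∞`. -/
structure GoodFn (f : ℝ → ℝ → ℝ → ℂ) : Prop where
  smooth : ContDiff ℝ (⊤ : ℕ∞) (fun p : ℝ × ℝ × ℝ => f p.1 p.2.1 p.2.2)
  per_x : ∀ x y z, f (x + 1) y z = f x y z
  per_z : ∀ x y z, f x y (z + 1) = f x y z
  decay : ∀ (α : ℕ × ℕ × ℕ) (n : ℕ), ∃ C : ℝ, ∀ x y z : ℝ,
    ‖pderiv3 α f x y z‖ * |y| ^ n ≤ C


open scoped ENNReal InnerProductSpace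

/-- The class of smooth functions on `ℝ³` as curried functions. -/
def Smooth3 (f : ℝ → ℝ → ℝ → ℂ) : Prop :=
  ContDiff ℝ (⊤ : ℕ∞) (fun p : ℝ × ℝ × ℝ => f p.1 p.2.1 p.2.2)

namespace Smooth3

variable {f g : ℝ → ℝ → ℝ → ℂ}

lemma differentiableAt (hf : Smooth3 f) (p : ℝ × ℝ × ℝ) :
    DifferentiableAt ℝ (fun p : ℝ × ℝ × ℝ => f p.1 p.2.1 p.2.2) p :=
  (ContDiff.differentiable hf (by simp)) p

lemma hasDerivAt_x_fderiv (hf : Smooth3 f) (x y z : ℝ) : HasDerivAt (fun t => f t y z)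
    (fderiv ℝ (fun p : ℝ × ℝ × ℝ => f p.1 p.2.1 p.2.2) (x, y, z) (1, 0, 0)) x :=
  HasFDerivAt.comp_hasDerivAt (l := fun p : ℝ × ℝ × ℝ => f p.1 p.2.1 p.2.2) x
    (hf.differentiableAt (x, y, z)).hasFDerivAt
    ((hasDerivAt_id x).prodMk ((hasDerivAt_const x y).prodMk (hasDerivAt_const x z)))

lemma hasDerivAt_y_fderiv (hf : Smooth3 f) (x y z : ℝ) : HasDerivAt (fun t => f x t z)
    (fderiv ℝ (fun p : ℝ × ℝ × ℝ => f p.1 p.2.1 p.2.2) (x, y, z) (0, 1, 0)) y :=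
  HasFDerivAt.comp_hasDerivAt (l := fun p : ℝ × ℝ × ℝ => f p.1 p.2.1 p.2.2) y
    (hf.differentiableAt (x, y, z)).hasFDerivAt
    ((hasDerivAt_const y x).prodMk ((hasDerivAt_id y).prodMk (hasDerivAt_const y z)))

lemma hasDerivAt_z_fderiv (hf : Smooth3 f) (x y z : ℝ) : HasDerivAt (fun t => f x y t)
    (fderiv ℝ (fun p : ℝ × ℝ × ℝ => f p.1 p.2.1 p.2.2) (x, y, z) (0, 0, 1)) z :=
  HasFDerivAt.comp_hasDerivAt (l := fun p : ℝ × ℝ × ℝ => f p.1 p.2.1 p.2.2) z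
    (hf.differentiableAt (x, y, z)).hasFDerivAt
    ((hasDerivAt_const z x).prodMk ((hasDerivAt_const z y).prodMk (hasDerivAt_id z)))

lemma pdx_eq (hf : Smooth3 f) (x y z : ℝ) :
    pdx f x y z = fderiv ℝ (fun p : ℝ × ℝ × ℝ => f p.1 p.2.1 p.2.2) (x, y, z) (1, 0, 0) :=
  (hf.hasDerivAt_x_fderiv x y z).deriv

lemma pdy_eq (hf : Smooth3 f) (x y z : ℝ) :
    pdy f x y z = fderiv ℝ (fun p : ℝ × ℝ × ℝ => f p.1 p.2.1 p.2.2) (x, y, z) (0, 1, 0) :=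
  (hf.hasDerivAt_y_fderiv x y z).deriv

lemma pdz_eq (hf : Smooth3 f) (x y z : ℝ) :
    pdz f x y z = fderiv ℝ (fun p : ℝ × ℝ × ℝ => f p.1 p.2.1 p.2.2) (x, y, z) (0, 0, 1) :=
  (hf.hasDerivAt_z_fderiv x y z).deriv

lemma hasDerivAt_x (hf : Smooth3 f) (x y z : ℝ) :
    HasDerivAt (fun t => f t y z) (pdx f x y z) x :=
  (hf.hasDerivAt_x_fderiv x y z).differentiableAt.hasDerivAt

lemma hasDerivAt_y (hf : Smooth3 f) (x y z : ℝ) :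
    HasDerivAt (fun t => f x t z) (pdy f x y z) y :=
  (hf.hasDerivAt_y_fderiv x y z).differentiableAt.hasDerivAt

lemma hasDerivAt_z (hf : Smooth3 f) (x y z : ℝ) :
    HasDerivAt (fun t => f x y t) (pdz f x y z) z :=
  (hf.hasDerivAt_z_fderiv x y z).differentiableAt.hasDerivAt

lemma contDiff_fderiv_apply (hf : Smooth3 f) (v : ℝ × ℝ × ℝ) :
    ContDiff ℝ (⊤ : ℕ∞)
      (fun p => fderiv ℝ (fun p : ℝ × ℝ × ℝ => f p.1 p.2.1 p.2.2) p v) :=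
  (ContDiff.fderiv_right hf (by simp)).clm_apply contDiff_const

lemma pdx (hf : Smooth3 f) : Smooth3 (pdx f) := by
  simpa only [Smooth3, hf.pdx_eq] using hf.contDiff_fderiv_apply (1, 0, 0)

lemma pdy (hf : Smooth3 f) : Smooth3 (pdy f) := by
  simpa only [Smooth3, hf.pdy_eq] using hf.contDiff_fderiv_apply (0, 1, 0)

lemma pdz (hf : Smooth3 f) : Smooth3 (pdz f) := by
  simpa only [Smooth3, hf.pdz_eq] using hf.contDiff_fderiv_apply (0, 0, 1)

lemma mul (hf : Smooth3 f) (hg : Smooth3 g) : Smooth3 (f * g) :=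
  ContDiff.mul (f := fun p : ℝ × ℝ × ℝ => f p.1 p.2.1 p.2.2) hf hg

lemma add (hf : Smooth3 f) (hg : Smooth3 g) : Smooth3 (f + g) :=
  ContDiff.add (f := fun p : ℝ × ℝ × ℝ => f p.1 p.2.1 p.2.2) hf hg

lemma fderiv_fderiv_comm (hf : Smooth3 f) (p v w : ℝ × ℝ × ℝ) :
    fderiv ℝ (fun q => fderiv ℝ (fun p : ℝ × ℝ × ℝ => f p.1 p.2.1 p.2.2) q v) p w =
      fderiv ℝ (fun q => fderiv ℝ (fun p : ℝ × ℝ × ℝ => f p.1 p.2.1 p.2.2) q w) p v := by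
  have hd : DifferentiableAt ℝ (fderiv ℝ (fun p : ℝ × ℝ × ℝ => f p.1 p.2.1 p.2.2)) p :=
    (ContDiff.differentiable (ContDiff.fderiv_right (m := (⊤ : ℕ∞)) hf (by simp)) (by simp)) p
  have hs := (ContDiff.contDiffAt hf (x := p)).isSymmSndFDerivAt 
    (by simpa using WithTop.coe_le_coe.2 (le_top (a := (2 : ℕ∞))))
  rw [fderiv_clm_apply hd (by fun_prop), fderiv_clm_apply hd (by fun_prop)]
  simpa using hs w v

lemma pdx_pdy (hf : Smooth3 f) : _root_.pdx (_root_.pdy f) = _root_.pdy (_root_.pdx f) := by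
  funext x y z
  rw [hf.pdy.pdx_eq, hf.pdx.pdy_eq]
  simp only [hf.pdx_eq, hf.pdy_eq]
  exact hf.fderiv_fderiv_comm _ _ _

lemma pdx_pdz (hf : Smooth3 f) : _root_.pdx (_root_.pdz f) = _root_.pdz (_root_.pdx f) := by
  funext x y z
  rw [hf.pdz.pdx_eq, hf.pdx.pdz_eq]
  simp only [hf.pdx_eq, hf.pdz_eq]
  exact hf.fderiv_fderiv_comm _ _ _

lemma pdy_pdz (hf : Smooth3 f) : _root_.pdy (_root_.pdz f) = _root_.pdz (_root_.pdy f) := by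
  funext x y z
  rw [hf.pdz.pdy_eq, hf.pdy.pdz_eq]
  simp only [hf.pdy_eq, hf.pdz_eq]
  exact hf.fderiv_fderiv_comm _ _ _

lemma pdx_mul (hf : Smooth3 f) (hg : Smooth3 g) :
    _root_.pdx (f * g) = _root_.pdx f * g + f * _root_.pdx g := by
  funext x y z
  exact ((hf.hasDerivAt_x x y z).mul (hg.hasDerivAt_x x y z)).deriv

lemma pdy_mul (hf : Smooth3 f) (hg : Smooth3 g) :
    _root_.pdy (f * g) = _root_.pdy f * g + f * _root_.pdy g := by
  funext x y z
  exact ((hf.hasDerivAt_y x y z).mul (hg.hasDerivAt_y x y z)).deriv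

lemma pdz_mul (hf : Smooth3 f) (hg : Smooth3 g) :
    _root_.pdz (f * g) = _root_.pdz f * g + f * _root_.pdz g := by
  funext x y z
  exact ((hf.hasDerivAt_z x y z).mul (hg.hasDerivAt_z x y z)).deriv

lemma pdx_add (hf : Smooth3 f) (hg : Smooth3 g) :
    _root_.pdx (f + g) = _root_.pdx f + _root_.pdx g := by
  funext x y z
  exact ((hf.hasDerivAt_x x y z).add (hg.hasDerivAt_x x y z)).deriv

lemma pdy_add (hf : Smooth3 f) (hg : Smooth3 g) :
    _root_.pdy (f + g) = _root_.pdy f + _root_.pdy g := by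
  funext x y z
  exact ((hf.hasDerivAt_y x y z).add (hg.hasDerivAt_y x y z)).deriv

lemma pdz_add (hf : Smooth3 f) (hg : Smooth3 g) :
    _root_.pdz (f + g) = _root_.pdz f + _root_.pdz g := by
  funext x y z
  exact ((hf.hasDerivAt_z x y z).add (hg.hasDerivAt_z x y z)).deriv

lemma iterate_pdx (hf : Smooth3 f) (n : ℕ) : Smooth3 (_root_.pdx^[n] f) := by
  induction n with
  | zero => exact hf
  | succ n ih => rw [Function.iterate_succ_apply']; exact ih.pdx

lemma iterate_pdy (hf : Smooth3 f) (n : ℕ) : Smooth3 (_root_.pdy^[n] f) := by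
  induction n with
  | zero => exact hf
  | succ n ih => rw [Function.iterate_succ_apply']; exact ih.pdy

lemma iterate_pdz (hf : Smooth3 f) (n : ℕ) : Smooth3 (_root_.pdz^[n] f) := by
  induction n with
  | zero => exact hf
  | succ n ih => rw [Function.iterate_succ_apply']; exact ih.pdz

lemma pderiv3 (hf : Smooth3 f) (α : ℕ × ℕ × ℕ) : Smooth3 (pderiv3 α f) :=
  ((hf.iterate_pdz _).iterate_pdy _).iterate_pdx _

lemma pdy_iterate_pdx (hf : Smooth3 f) (n : ℕ) :
    _root_.pdy (_root_.pdx^[n] f) = _root_.pdx^[n] (_root_.pdy f) := by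
  induction n with
  | zero => rfl
  | succ n ih =>
    rw [Function.iterate_succ_apply', Function.iterate_succ_apply', ← ih,
      (hf.iterate_pdx n).pdx_pdy]

lemma pdz_iterate_pdx (hf : Smooth3 f) (n : ℕ) :
    _root_.pdz (_root_.pdx^[n] f) = _root_.pdx^[n] (_root_.pdz f) := by
  induction n with
  | zero => rfl
  | succ n ih =>
    rw [Function.iterate_succ_apply', Function.iterate_succ_apply', ← ih,
      (hf.iterate_pdx n).pdx_pdz]

lemma pdz_iterate_pdy (hf : Smooth3 f) (n : ℕ) :
    _root_.pdz (_root_.pdy^[n] f) = _root_.pdy^[n] (_root_.pdz f) := by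
  induction n with
  | zero => rfl
  | succ n ih =>
    rw [Function.iterate_succ_apply', Function.iterate_succ_apply', ← ih,
      (hf.iterate_pdy n).pdy_pdz]

lemma pdy_pderiv3 (hf : Smooth3 f) (a b c : ℕ) :
    _root_.pdy (_root_.pderiv3 (a, b, c) f) = _root_.pderiv3 (a, b + 1, c) f := by
  simp only [_root_.pderiv3]
  rw [((hf.iterate_pdz _).iterate_pdy _).pdy_iterate_pdx, Function.iterate_succ_apply']

lemma pdz_pderiv3 (hf : Smooth3 f) (a b c : ℕ) :
    _root_.pdz (_root_.pderiv3 (a, b, c) f) = _root_.pderiv3 (a, b, c + 1) f := by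
  simp only [_root_.pderiv3]
  rw [((hf.iterate_pdz _).iterate_pdy _).pdz_iterate_pdx, (hf.iterate_pdz _).pdz_iterate_pdy,
    Function.iterate_succ_apply']

end Smooth3

lemma pdx_pderiv3 (f : ℝ → ℝ → ℝ → ℂ) (a b c : ℕ) :
    pdx (pderiv3 (a, b, c) f) = pderiv3 (a + 1, b, c) f := by
  simp only [pderiv3]
  rw [Function.iterate_succ_apply']

lemma pderiv3_pderiv3 {f : ℝ → ℝ → ℝ → ℂ} (hf : Smooth3 f) (a b c a' b' c' : ℕ) :
    pderiv3 (a, b, c) (pderiv3 (a', b', c') f) =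
      pderiv3 (a + a', b + b', c + c') f := by
  have hz : pdz^[c] (pderiv3 (a', b', c') f) = pderiv3 (a', b', c + c') f := by
    induction c with
    | zero => simp
    | succ n ih =>
      rw [Function.iterate_succ_apply', ih, hf.pdz_pderiv3]
      congr 3; omega
  have hy : pdy^[b] (pderiv3 (a', b', c + c') f) = pderiv3 (a', b + b', c + c') f := by
    induction b with
    | zero => simp
    | succ n ih =>
      rw [Function.iterate_succ_apply', ih, hf.pdy_pderiv3]
      congr 3; omega
  have hx : pdx^[a] (pderiv3 (a', b + b', c + c') f) = pderiv3 (a + a', b + b', c + c') f := by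
    induction a with
    | zero => simp
    | succ n ih =>
      rw [Function.iterate_succ_apply', ih, pdx_pderiv3]
      congr 2; omega
  rw [← hx, ← hy, ← hz]
  rfl

/-- Functions which are `1`-periodic in the first variable. -/
def PeriodicX (f : ℝ → ℝ → ℝ → ℂ) : Prop := ∀ x y z, f (x + 1) y z = f x y z

namespace PeriodicX

variable {f : ℝ → ℝ → ℝ → ℂ}

lemma pdx (hf : PeriodicX f) : PeriodicX (pdx f) := by
  intro x y z
  simp only [_root_.pdx]
  rw [← deriv_comp_add_const]
  simp only [hf _ y z]

lemma pdy (hf : PeriodicX f) : PeriodicX (pdy f) := by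
  intro x y z
  simp only [_root_.pdy, hf x _ z]

lemma pdz (hf : PeriodicX f) : PeriodicX (pdz f) := by
  intro x y z
  simp only [_root_.pdz, hf x y _]

lemma pderiv3 (hf : PeriodicX f) (α : ℕ × ℕ × ℕ) : PeriodicX (pderiv3 α f) := by
  have hz : ∀ n, PeriodicX (_root_.pdz^[n] f) := fun n => by
    induction n with
    | zero => exact hf
    | succ n ih => rw [Function.iterate_succ_apply']; exact ih.pdz
  have hy : ∀ m n, PeriodicX (_root_.pdy^[m] (_root_.pdz^[n] f)) := fun m n => by
    induction m with
    | zero => exact hz n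
    | succ m ih => rw [Function.iterate_succ_apply']; exact ih.pdy
  have hx : ∀ l m n, PeriodicX (_root_.pdx^[l] (_root_.pdy^[m] (_root_.pdz^[n] f))) :=
    fun l m n => by
    induction l with
    | zero => exact hy m n
    | succ l ih => rw [Function.iterate_succ_apply']; exact ih.pdx
  exact hx _ _ _

end PeriodicX

/-- The measure on the fundamental domain `(0, 1] × ℝ × (0, 1]` of `𝕋 × ℝ × 𝕋`. -/
def stripMeasure : Measure (ℝ × ℝ × ℝ) :=
  (volume.restrict (Set.Ioc (0 : ℝ) 1)).prod
    (volume.prod (volume.restrict (Set.Ioc (0 : ℝ) 1)))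

/-- The squared `L²` norm over the strip, with values in `[0, ∞]`. -/
def eL2sq (f : ℝ → ℝ → ℝ → ℂ) : ℝ≥0∞ :=
  ∫⁻ p, ‖f p.1 p.2.1 p.2.2‖ₑ ^ 2 ∂stripMeasure

lemma Smooth3.continuous {f : ℝ → ℝ → ℝ → ℂ} (hf : Smooth3 f) :
    Continuous (fun p : ℝ × ℝ × ℝ => f p.1 p.2.1 p.2.2) :=
  ContDiff.continuous hf

lemma Smooth3.continuous_comp {X : Type*} [TopologicalSpace X] {f : ℝ → ℝ → ℝ → ℂ}
    (hf : Smooth3 f) {a b c : X → ℝ} (ha : Continuous a) (hb : Continuous b)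
    (hc : Continuous c) : Continuous (fun t => f (a t) (b t) (c t)) :=
  hf.continuous.comp (ha.prodMk (hb.prodMk hc))

lemma ae_stripMeasure_mem : ∀ᵐ p ∂stripMeasure,
    p.1 ∈ Set.Ioc (0 : ℝ) 1 ∧ p.2.2 ∈ Set.Ioc (0 : ℝ) 1 := by
  have h : stripMeasure = (volume.prod (volume.prod volume)).restrict
      (Set.Ioc (0 : ℝ) 1 ×ˢ (Set.univ ×ˢ Set.Ioc (0 : ℝ) 1)) := by
    rw [stripMeasure, ← Measure.prod_restrict, ← Measure.prod_restrict, Measure.restrict_univ]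
  rw [h]
  filter_upwards [ae_restrict_mem (by measurability)] with p hp
  exact ⟨hp.1, hp.2.2⟩

lemma enorm_mul_le_sq_add_sq (a b : ℂ) : 2 * (‖a‖ₑ * ‖b‖ₑ) ≤ ‖a‖ₑ ^ 2 + ‖b‖ₑ ^ 2 := by
  simp only [enorm_eq_nnnorm]
  norm_cast
  have := two_mul_le_add_sq ‖a‖₊ ‖b‖₊
  linarith [mul_assoc 2 ‖a‖₊ ‖b‖₊]

lemma ENNReal.add_sq_le (a b : ℝ≥0∞) : (a + b) ^ 2 ≤ 2 * a ^ 2 + 2 * b ^ 2 := by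
  rcases eq_or_ne a ∞ with rfl | ha
  · simp
  rcases eq_or_ne b ∞ with rfl | hb
  · simp
  lift a to NNReal using ha
  lift b to NNReal using hb
  norm_cast
  rw [← mul_add]
  exact _root_.add_sq_le

lemma ENNReal.mul_le_sq_add_sq (a b : ℝ≥0∞) : a * b ≤ a ^ 2 + b ^ 2 := by
  rcases le_total a b with h | h
  · calc a * b ≤ b * b := by gcongr
      _ ≤ a ^ 2 + b ^ 2 := by rw [sq b]; exact le_add_self
  · calc a * b ≤ a * a := by gcongr
      _ ≤ a ^ 2 + b ^ 2 := by rw [sq a]; exact le_self_add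

/-- The Cauchy–Schwarz inequality for the Lebesgue integral of `[0, ∞]`-valued functions. -/
lemma lintegral_mul_sq_le {X : Type*} [MeasurableSpace X] (μ : Measure X) {u v : X → ℝ≥0∞}
    (hu : AEMeasurable u μ) (hv : AEMeasurable v μ) :
    (∫⁻ t, u t * v t ∂μ) ^ 2 ≤ (∫⁻ t, u t ^ 2 ∂μ) * ∫⁻ t, v t ^ 2 ∂μ := by
  have h := ENNReal.lintegral_mul_le_Lp_mul_Lq μ Real.HolderConjugate.two_two hu hv
  simp only [Pi.mul_apply, ENNReal.rpow_two] at h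
  have hs : ∀ c : ℝ≥0∞, (c ^ (1 / 2 : ℝ)) ^ 2 = c := fun c => by
    rw [← ENNReal.rpow_two, ← ENNReal.rpow_mul]; norm_num
  calc _ ≤ _ := pow_le_pow_left' h 2
    _ = _ := by rw [mul_pow, hs, hs]

/-- A function on the line is controlled at a point by integrals over a unit interval. -/
lemma enorm_le_lintegral_Ioc {w w' : ℝ → ℝ} (hw : ∀ t, HasDerivAt w (w' t) t)
    (hw' : Continuous w') {a t : ℝ} (ht : t ∈ Set.Icc a (a + 1)) :
    ‖w t‖ₑ ≤ ∫⁻ s in Set.Ioc a (a + 1), (‖w s‖ₑ + ‖w' s‖ₑ) := by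
  have hwc : Continuous w := continuous_iff_continuousAt.2 fun t => (hw t).continuousAt
  have hK : ∀ s ∈ Set.Ioc a (a + 1),
      ‖w t‖ₑ ≤ ‖w s‖ₑ + ∫⁻ r in Set.Ioc a (a + 1), ‖w' r‖ₑ := fun s hs => by
    have h := intervalIntegral.integral_eq_sub_of_hasDerivAt (a := s) (b := t) (f := w)
      (fun r _ => hw r) (hw'.intervalIntegrable _ _)
    have h1 : w t = w s + ∫ r in s..t, w' r := by rw [h]; ring
    have h2 : ‖∫ r in s..t, w' r‖ₑ ≤ ∫⁻ r in Set.Ioc a (a + 1), ‖w' r‖ₑ := by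
      have : ‖∫ r in s..t, w' r‖ₑ = ‖∫ r in Set.uIoc s t, w' r‖ₑ := by
        rw [← ofReal_norm, ← ofReal_norm, intervalIntegral.norm_intervalIntegral_eq]
      rw [this]
      refine (enorm_integral_le_lintegral_enorm _).trans (lintegral_mono_set ?_)
      intro r hr
      rw [Set.uIoc, Set.mem_Ioc] at hr
      exact ⟨lt_of_le_of_lt (le_min hs.1.le ht.1) hr.1, hr.2.trans (max_le hs.2 ht.2)⟩
    rw [h1]
    exact (enorm_add_le _ _).trans (by gcongr)
  have hm : volume (Set.Ioc a (a + 1)) = 1 := by simp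
  calc ‖w t‖ₑ = ∫⁻ _ in Set.Ioc a (a + 1), ‖w t‖ₑ := by simp
    _ ≤ ∫⁻ s in Set.Ioc a (a + 1), (‖w s‖ₑ + ∫⁻ r in Set.Ioc a (a + 1), ‖w' r‖ₑ) :=
        setLIntegral_mono' measurableSet_Ioc hK
    _ = _ := by
        rw [lintegral_add_left (by fun_prop), lintegral_add_left (by fun_prop)]
        simp

lemma sq_enorm_le_lintegral_Ioc {v v' : ℝ → ℂ} (hv : ∀ t, HasDerivAt v (v' t) t)
    (hv' : Continuous v') {a t : ℝ} (ht : t ∈ Set.Icc a (a + 1)) :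
    ‖v t‖ₑ ^ 2 ≤ ∫⁻ s in Set.Ioc a (a + 1), (‖v s‖ₑ ^ 2 + 2 * (‖v s‖ₑ * ‖v' s‖ₑ)) := by
  have hvc : Continuous v := continuous_iff_continuousAt.2 fun t => (hv t).continuousAt
  have h := enorm_le_lintegral_Ioc (w := fun s => ‖v s‖ ^ 2) (w' := fun s => 2 * ⟪v s, v' s⟫_ℝ)
    (fun s => (hv s).norm_sq) (by fun_prop) ht
  calc ‖v t‖ₑ ^ 2 = ‖‖v t‖ ^ 2‖ₑ := by rw [enorm_pow, enorm_norm]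
    _ ≤ _ := h
    _ ≤ _ := by
      refine lintegral_mono fun s => ?_
      gcongr
      · rw [enorm_pow, enorm_norm]
      · rw [enorm_mul]
        gcongr
        · simp [← ofReal_norm]
        · rw [← ofReal_norm, ← ofReal_norm, ← ofReal_norm, ← ENNReal.ofReal_mul (norm_nonneg _)]
          exact ENNReal.ofReal_le_ofReal (norm_inner_le_norm _ _)

/-- The squared `L²` norm of the slice of `f` at a fixed value of `x`. -/
def sliceSq (f : ℝ → ℝ → ℝ → ℂ) (x : ℝ) : ℝ≥0∞ :=
  ∫⁻ q : ℝ × ℝ, ‖f x q.1 q.2‖ₑ ^ 2 ∂(volume.prod (volume.restrict (Set.Ioc (0 : ℝ) 1)))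

namespace Smooth3

variable {f g : ℝ → ℝ → ℝ → ℂ}

lemma measurable_sliceSq (hf : Smooth3 f) : Measurable (sliceSq f) := by
  have : Measurable (fun p : ℝ × ℝ × ℝ => ‖f p.1 p.2.1 p.2.2‖ₑ ^ 2) :=
    (hf.continuous.enorm.measurable.pow_const 2)
  exact this.lintegral_prod_right'

lemma lintegral_sliceSq (hf : Smooth3 f) :
    ∫⁻ x in Set.Ioc (0 : ℝ) 1, sliceSq f x = eL2sq f := by
  rw [eL2sq, stripMeasure,
    lintegral_prod _ (hf.continuous.enorm.measurable.pow_const 2).aemeasurable]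
  rfl

lemma lintegral_sq_add_le (hf : Smooth3 f) (hg : Smooth3 g) :
    ∫⁻ p, (‖f p.1 p.2.1 p.2.2‖ₑ ^ 2 +
      2 * (‖f p.1 p.2.1 p.2.2‖ₑ * ‖g p.1 p.2.1 p.2.2‖ₑ)) ∂stripMeasure
      ≤ 2 * eL2sq f + eL2sq g := by
  have h1 := hf.continuous.measurable
  have h2 := hg.continuous.measurable
  calc _ ≤ ∫⁻ p, (2 * ‖f p.1 p.2.1 p.2.2‖ₑ ^ 2 + ‖g p.1 p.2.1 p.2.2‖ₑ ^ 2) ∂stripMeasure := by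
        refine lintegral_mono fun p => ?_
        refine (add_le_add_right (enorm_mul_le_sq_add_sq _ _) _).trans_eq ?_
        ring
    _ = _ := by
        rw [lintegral_add_left (by fun_prop), lintegral_const_mul _ (by fun_prop)]
        rfl

lemma sliceSq_le (hf : Smooth3 f) {x : ℝ} (hx : x ∈ Set.Ioc (0 : ℝ) 1) :
    sliceSq f x ≤ 2 * eL2sq f + eL2sq (_root_.pdx f) := by
  refine le_trans ?_ (hf.lintegral_sq_add_le hf.pdx)
  have h1 := hf.continuous.measurable
  have h2 := hf.pdx.continuous.measurable
  rw [stripMeasure, lintegral_prod_symm _ (by fun_prop)]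
  refine lintegral_mono fun q => ?_
  have := sq_enorm_le_lintegral_Ioc (v := fun t => f t q.1 q.2)
    (v' := fun t => _root_.pdx f t q.1 q.2) (fun t => hf.hasDerivAt_x t q.1 q.2)
    (hf.pdx.continuous_comp continuous_id continuous_const continuous_const)
    (a := 0) (t := x) (by simpa using ⟨hx.1.le, hx.2⟩)
  simpa using this

lemma lintegral_slice_sq_le (hf : Smooth3 f) (hg : Smooth3 g) (x : ℝ) :
    (∫⁻ q : ℝ × ℝ, (‖f x q.1 q.2‖ₑ ^ 2 + 2 * (‖f x q.1 q.2‖ₑ * ‖g x q.1 q.2‖ₑ))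
      ∂(volume.prod (volume.restrict (Set.Ioc (0 : ℝ) 1)))) ^ 2
      ≤ sliceSq f x * (2 * sliceSq f x + 8 * sliceSq g x) := by
  have h1 : Measurable fun q : ℝ × ℝ => f x q.1 q.2 :=
    (hf.continuous_comp continuous_const continuous_fst continuous_snd).measurable
  have h2 : Measurable fun q : ℝ × ℝ => g x q.1 q.2 :=
    (hg.continuous_comp continuous_const continuous_fst continuous_snd).measurable
  rw [lintegral_add_left (by fun_prop), lintegral_const_mul _ (by fun_prop)]
  refine (ENNReal.add_sq_le _ _).trans ?_
  rw [mul_pow]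
  calc _ ≤ 2 * sliceSq f x ^ 2 + 2 * (2 ^ 2 * (sliceSq f x * sliceSq g x)) := by
        gcongr
        · exact le_rfl
        · exact lintegral_mul_sq_le _ (by fun_prop) (by fun_prop)
    _ = _ := by ring

lemma lintegral_slice_pow_four_le (hf : Smooth3 f) (x : ℝ) :
    ∫⁻ q : ℝ × ℝ, ‖f x q.1 q.2‖ₑ ^ 4 ∂(volume.prod (volume.restrict (Set.Ioc (0 : ℝ) 1)))
      ≤ sliceSq f x *
        (4 * sliceSq f x + 8 * sliceSq (_root_.pdy f) x + 8 * sliceSq (_root_.pdz f) x) := by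
  have h1 : Measurable fun q : ℝ × ℝ => f x q.1 q.2 :=
    (hf.continuous_comp continuous_const continuous_fst continuous_snd).measurable
  have h2 : Measurable fun q : ℝ × ℝ => _root_.pdy f x q.1 q.2 :=
    (hf.pdy.continuous_comp continuous_const continuous_fst continuous_snd).measurable
  have h3 : Measurable fun q : ℝ × ℝ => _root_.pdz f x q.1 q.2 :=
    (hf.pdz.continuous_comp continuous_const continuous_fst continuous_snd).measurable
  have hmy : Measurable fun q : ℝ × ℝ =>
      ‖f x q.1 q.2‖ₑ ^ 2 + 2 * (‖f x q.1 q.2‖ₑ * ‖_root_.pdy f x q.1 q.2‖ₑ) := by fun_prop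
  have hmz : Measurable fun q : ℝ × ℝ =>
      ‖f x q.1 q.2‖ₑ ^ 2 + 2 * (‖f x q.1 q.2‖ₑ * ‖_root_.pdz f x q.1 q.2‖ₑ) := by fun_prop
  have hz : ∀ y : ℝ, ∀ z ∈ Set.Ioc (0 : ℝ) 1, ‖f x y z‖ₑ ^ 2 ≤ ∫⁻ t in Set.Ioc (0 : ℝ) 1,
      (‖f x y t‖ₑ ^ 2 + 2 * (‖f x y t‖ₑ * ‖_root_.pdz f x y t‖ₑ)) := fun y z hz => by
    have := sq_enorm_le_lintegral_Ioc (v := fun t => f x y t) (v' := fun t => _root_.pdz f x y t)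
      (fun t => hf.hasDerivAt_z x y t)
      (hf.pdz.continuous_comp continuous_const continuous_const continuous_id)
      (a := 0) (t := z) (by simpa using ⟨hz.1.le, hz.2⟩)
    simpa using this
  have hy : ∀ y z : ℝ, ‖f x y z‖ₑ ^ 2 ≤ ∫⁻ t,
      (‖f x t z‖ₑ ^ 2 + 2 * (‖f x t z‖ₑ * ‖_root_.pdy f x t z‖ₑ)) := fun y z => by
    have := sq_enorm_le_lintegral_Ioc (v := fun t => f x t z) (v' := fun t => _root_.pdy f x t z)
      (fun t => hf.hasDerivAt_y x t z)
      (hf.pdy.continuous_comp continuous_const continuous_id continuous_const)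
      (a := y) (t := y) (by simp)
    exact this.trans (setLIntegral_le_lintegral _ _)
  have hmem : ∀ᵐ q ∂(volume : Measure ℝ).prod (volume.restrict (Set.Ioc (0 : ℝ) 1)),
      q.2 ∈ Set.Ioc (0 : ℝ) 1 :=
    Measure.quasiMeasurePreserving_snd.ae (ae_restrict_mem measurableSet_Ioc)
  calc _ ≤ ∫⁻ q : ℝ × ℝ, (∫⁻ t in Set.Ioc (0 : ℝ) 1,
          (‖f x q.1 t‖ₑ ^ 2 + 2 * (‖f x q.1 t‖ₑ * ‖_root_.pdz f x q.1 t‖ₑ))) *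
          (∫⁻ t, (‖f x t q.2‖ₑ ^ 2 + 2 * (‖f x t q.2‖ₑ * ‖_root_.pdy f x t q.2‖ₑ)))
          ∂(volume.prod (volume.restrict (Set.Ioc (0 : ℝ) 1))) := by
        refine lintegral_mono_ae ?_
        filter_upwards [hmem] with q hq
        rw [show 4 = 2 + 2 from rfl, pow_add]
        exact mul_le_mul' (hz _ _ hq) (hy _ _)
    _ = (∫⁻ q : ℝ × ℝ, (‖f x q.1 q.2‖ₑ ^ 2 + 2 * (‖f x q.1 q.2‖ₑ * ‖_root_.pdz f x q.1 q.2‖ₑ))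
          ∂(volume.prod (volume.restrict (Set.Ioc (0 : ℝ) 1)))) *
        (∫⁻ q : ℝ × ℝ, (‖f x q.1 q.2‖ₑ ^ 2 + 2 * (‖f x q.1 q.2‖ₑ * ‖_root_.pdy f x q.1 q.2‖ₑ))
          ∂(volume.prod (volume.restrict (Set.Ioc (0 : ℝ) 1)))) := by
        rw [lintegral_prod _ hmz.aemeasurable, lintegral_prod_symm _ hmy.aemeasurable]
        exact lintegral_prod_mul hmz.lintegral_prod_right'.aemeasurable
          hmy.lintegral_prod_left'.aemeasurable
    _ ≤ _ := ENNReal.mul_le_sq_add_sq _ _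
    _ ≤ _ := add_le_add (hf.lintegral_slice_sq_le hf.pdz x) (hf.lintegral_slice_sq_le hf.pdy x)
    _ = _ := by ring

/-- The embedding `H¹ ⊂ L⁴` on the strip. -/
lemma lintegral_pow_four_le (hf : Smooth3 f) :
    ∫⁻ p, ‖f p.1 p.2.1 p.2.2‖ₑ ^ 4 ∂stripMeasure ≤ 16 * (eL2sq f + eL2sq (_root_.pdx f) +
      eL2sq (_root_.pdy f) + eL2sq (_root_.pdz f)) ^ 2 := by
  have h1 := hf.continuous.measurable
  have m1 := hf.measurable_sliceSq
  have m2 := hf.pdy.measurable_sliceSq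
  have m3 := hf.pdz.measurable_sliceSq
  set E := eL2sq f + eL2sq (_root_.pdx f) + eL2sq (_root_.pdy f) + eL2sq (_root_.pdz f) with hE
  rw [stripMeasure, lintegral_prod _ (by fun_prop)]
  calc _ ≤ ∫⁻ x in Set.Ioc (0 : ℝ) 1, (2 * eL2sq f + eL2sq (_root_.pdx f)) *
        (4 * sliceSq f x + 8 * sliceSq (_root_.pdy f) x + 8 * sliceSq (_root_.pdz f) x) :=
        setLIntegral_mono' measurableSet_Ioc fun x hx =>
          (hf.lintegral_slice_pow_four_le x).trans (mul_le_mul_left (hf.sliceSq_le hx) _)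
    _ = (2 * eL2sq f + eL2sq (_root_.pdx f)) *
        (4 * eL2sq f + 8 * eL2sq (_root_.pdy f) + 8 * eL2sq (_root_.pdz f)) := by
        rw [lintegral_const_mul _ (by fun_prop), lintegral_add_left (by fun_prop),
          lintegral_add_left (by fun_prop), lintegral_const_mul _ (by fun_prop),
          lintegral_const_mul _ (by fun_prop), lintegral_const_mul _ (by fun_prop),
          hf.lintegral_sliceSq, hf.pdy.lintegral_sliceSq, hf.pdz.lintegral_sliceSq]
    _ ≤ (2 * E) * (8 * E) := by
        gcongr
        · calc _ ≤ 2 * eL2sq f + 2 * eL2sq (_root_.pdx f) := by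
                gcongr
                exact le_mul_of_one_le_left' one_le_two
            _ = 2 * (eL2sq f + eL2sq (_root_.pdx f)) := by ring
            _ ≤ 2 * E := by
                rw [hE, add_assoc (_ + _)]
                exact mul_le_mul_right le_self_add _
        · calc _ ≤ 8 * eL2sq f + 8 * eL2sq (_root_.pdy f) + 8 * eL2sq (_root_.pdz f) := by
                gcongr
                norm_num
            _ = 8 * (eL2sq f + eL2sq (_root_.pdy f) + eL2sq (_root_.pdz f)) := by ring
            _ ≤ 8 * E := by
                rw [hE]
                gcongr
                exact le_self_add
    _ = _ := by ring

/-- The product of two `H¹` functions on the strip is in `L²`. -/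
lemma eL2sq_mul_le (hf : Smooth3 f) (hg : Smooth3 g) :
    eL2sq (f * g) ≤ 16 * ((eL2sq f + eL2sq (_root_.pdx f) +
      eL2sq (_root_.pdy f) + eL2sq (_root_.pdz f)) * (eL2sq g + eL2sq (_root_.pdx g) +
      eL2sq (_root_.pdy g) + eL2sq (_root_.pdz g))) := by
  have h1 := hf.continuous.measurable
  have h2 := hg.continuous.measurable
  have h := lintegral_mul_sq_le stripMeasure (u := fun p => ‖f p.1 p.2.1 p.2.2‖ₑ ^ 2)
    (v := fun p => ‖g p.1 p.2.1 p.2.2‖ₑ ^ 2) (by fun_prop) (by fun_prop)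
  simp only [← pow_mul, ← mul_pow] at h
  rw [← ENNReal.pow_le_pow_left_iff two_ne_zero]
  calc eL2sq (f * g) ^ 2 = (∫⁻ p, (‖f p.1 p.2.1 p.2.2‖ₑ * ‖g p.1 p.2.1 p.2.2‖ₑ) ^ 2
        ∂stripMeasure) ^ 2 := by simp [eL2sq, enorm_mul]
    _ ≤ _ := h
    _ ≤ _ := mul_le_mul' hf.lintegral_pow_four_le hg.lintegral_pow_four_le
    _ = _ := by ring

end Smooth3

lemma hasDerivAt_integral_of_continuous {g g' : ℝ → ℝ → ℝ}
    (hg : Continuous fun p : ℝ × ℝ => g p.1 p.2)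
    (hg' : Continuous fun p : ℝ × ℝ => g' p.1 p.2)
    (hd : ∀ s t, HasDerivAt (fun s => g s t) (g' s t) s) (a b s₀ : ℝ) :
    HasDerivAt (fun s => ∫ t in a..b, g s t) (∫ t in a..b, g' s₀ t) s₀ := by
  obtain ⟨C, hC⟩ := ((isCompact_closedBall s₀ 1).prod
    (isCompact_uIcc (a := a) (b := b))).exists_bound_of_continuousOn
    hg'.continuousOn
  have hs : ∀ s, Continuous fun t => g s t := fun s =>
    hg.comp (continuous_const.prodMk continuous_id)
  have hs' : ∀ s, Continuous fun t => g' s t := fun s =>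
    hg'.comp (continuous_const.prodMk continuous_id)
  refine (intervalIntegral.hasDerivAt_integral_of_dominated_loc_of_deriv_le
    (bound := fun _ => C) (Metric.closedBall_mem_nhds s₀ one_pos)
    (Filter.Eventually.of_forall fun s => (hs s).aestronglyMeasurable)
    ((hs s₀).intervalIntegrable _ _) (hs' s₀).aestronglyMeasurable ?_
    intervalIntegrable_const ?_).2
  · exact Filter.Eventually.of_forall fun t ht s hs => hC (s, t) ⟨hs, Set.uIoc_subset_uIcc ht⟩
  · exact Filter.Eventually.of_forall fun t _ s _ => hd s t

/-- A function of two variables on `ℝ × (0, 1]` is controlled at a point by the `L¹` norms of its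
mixed derivatives of order at most one in each variable. -/
lemma enorm_le_lintegral_plane {φ φy φz φyz : ℝ → ℝ → ℝ}
    (hφ : Continuous fun q : ℝ × ℝ => φ q.1 q.2) (hφy : Continuous fun q : ℝ × ℝ => φy q.1 q.2)
    (hφz : Continuous fun q : ℝ × ℝ => φz q.1 q.2) (hφyz : Continuous fun q : ℝ × ℝ => φyz q.1 q.2)
    (dy : ∀ y z, HasDerivAt (fun s => φ s z) (φy y z) y)
    (dz : ∀ y z, HasDerivAt (fun s => φ y s) (φz y z) z)
    (dyz : ∀ y z, HasDerivAt (fun s => φy y s) (φyz y z) z)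
    (y : ℝ) {z : ℝ} (hz : z ∈ Set.Ioc (0 : ℝ) 1) :
    ‖φ y z‖ₑ ≤ ∫⁻ q : ℝ × ℝ, (‖φ q.1 q.2‖ₑ + ‖φz q.1 q.2‖ₑ + (‖φy q.1 q.2‖ₑ + ‖φyz q.1 q.2‖ₑ))
      ∂(volume.prod (volume.restrict (Set.Ioc (0 : ℝ) 1))) := by
  have hz' : z ∈ Set.Icc (0 : ℝ) (0 + 1) := by simpa using ⟨hz.1.le, hz.2⟩
  have hr : ∀ {ψ : ℝ → ℝ → ℝ}, (Continuous fun q : ℝ × ℝ => ψ q.1 q.2) → ∀ s,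
      Continuous fun t => ψ s t := fun h s => h.comp (continuous_const.prodMk continuous_id)
  have hl : ∀ {ψ : ℝ → ℝ → ℝ}, (Continuous fun q : ℝ × ℝ => ψ q.1 q.2) → ∀ t,
      Continuous fun s => ψ s t := fun h t => h.comp (continuous_id.prodMk continuous_const)
  have m1 := (hφ.enorm.measurable.add hφz.enorm.measurable).add
    (hφy.enorm.measurable.add hφyz.enorm.measurable)
  calc ‖φ y z‖ₑ ≤ ∫⁻ s in Set.Ioc y (y + 1), (‖φ s z‖ₑ + ‖φy s z‖ₑ) :=
        enorm_le_lintegral_Ioc (fun s => dy s z) (hl hφy z) (by simp)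
    _ ≤ ∫⁻ s, (‖φ s z‖ₑ + ‖φy s z‖ₑ) := setLIntegral_le_lintegral _ _
    _ ≤ ∫⁻ s, ∫⁻ t in Set.Ioc (0 : ℝ) 1,
          (‖φ s t‖ₑ + ‖φz s t‖ₑ + (‖φy s t‖ₑ + ‖φyz s t‖ₑ)) := by
        refine lintegral_mono fun s => ?_
        have m2 : Measurable fun t => ‖φ s t‖ₑ + ‖φz s t‖ₑ :=
          (hr hφ s).enorm.measurable.add (hr hφz s).enorm.measurable
        rw [lintegral_add_left m2]
        have h1 := enorm_le_lintegral_Ioc (dz s) (hr hφz s) hz'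
        have h2 := enorm_le_lintegral_Ioc (dyz s) (hr hφyz s) hz'
        rw [zero_add] at h1 h2
        exact add_le_add h1 h2
    _ = _ := (lintegral_prod _ m1.aemeasurable).symm

/-- The real `L²` inner product over a period in `x`. -/
def innerX (v w : ℝ → ℝ → ℝ → ℂ) (y z : ℝ) : ℝ :=
  ∫ x in (0 : ℝ)..1, ⟪v x y z, w x y z⟫_ℝ

lemma innerX_comm (v w : ℝ → ℝ → ℝ → ℂ) : innerX v w = innerX w v := by
  funext y z
  simp only [innerX, real_inner_comm]

namespace Smooth3

variable {v w : ℝ → ℝ → ℝ → ℂ}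

lemma continuous_inner (hv : Smooth3 v) (hw : Smooth3 w) :
    Continuous fun p : ℝ × ℝ × ℝ => ⟪v p.1 p.2.1 p.2.2, w p.1 p.2.1 p.2.2⟫_ℝ :=
  hv.continuous.inner hw.continuous

lemma continuous_innerX (hv : Smooth3 v) (hw : Smooth3 w) :
    Continuous fun q : ℝ × ℝ => innerX v w q.1 q.2 := by
  refine intervalIntegral.continuous_parametric_intervalIntegral_of_continuous'
    (f := fun (q : ℝ × ℝ) x => ⟪v x q.1 q.2, w x q.1 q.2⟫_ℝ) ?_ 0 1
  exact (hv.continuous_inner hw).comp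
    (continuous_snd.prodMk ((continuous_fst.comp continuous_fst).prodMk
      (continuous_snd.comp continuous_fst)))

lemma intervalIntegrable_inner (hv : Smooth3 v) (hw : Smooth3 w) (y z a b : ℝ) :
    IntervalIntegrable (fun x => ⟪v x y z, w x y z⟫_ℝ) volume a b :=
  ((hv.continuous_inner hw).comp (continuous_id.prodMk
    (continuous_const.prodMk continuous_const))).intervalIntegrable a b

lemma hasDerivAt_innerX_y (hv : Smooth3 v) (hw : Smooth3 w) (y z : ℝ) :
    HasDerivAt (fun s => innerX v w s z)
      (innerX v (_root_.pdy w) y z + innerX (_root_.pdy v) w y z) y := by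
  have hc : Continuous fun p : ℝ × ℝ => (p.2, p.1, z) :=
    continuous_snd.prodMk (continuous_fst.prodMk continuous_const)
  have h := hasDerivAt_integral_of_continuous
    (g := fun s x => ⟪v x s z, w x s z⟫_ℝ)
    (g' := fun s x => ⟪v x s z, _root_.pdy w x s z⟫_ℝ + ⟪_root_.pdy v x s z, w x s z⟫_ℝ)
    ((hv.continuous_inner hw).comp hc)
    (((hv.continuous_inner hw.pdy).comp hc).add ((hv.pdy.continuous_inner hw).comp hc))
    (fun s x => (hv.hasDerivAt_y x s z).inner ℝ (hw.hasDerivAt_y x s z)) 0 1 y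
  rwa [intervalIntegral.integral_add (hv.intervalIntegrable_inner hw.pdy y z 0 1)
    (hv.pdy.intervalIntegrable_inner hw y z 0 1)] at h

lemma hasDerivAt_innerX_z (hv : Smooth3 v) (hw : Smooth3 w) (y z : ℝ) :
    HasDerivAt (fun s => innerX v w y s)
      (innerX v (_root_.pdz w) y z + innerX (_root_.pdz v) w y z) z := by
  have hc : Continuous fun p : ℝ × ℝ => (p.2, y, p.1) :=
    continuous_snd.prodMk (continuous_const.prodMk continuous_fst)
  have h := hasDerivAt_integral_of_continuous
    (g := fun s x => ⟪v x y s, w x y s⟫_ℝ)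
    (g' := fun s x => ⟪v x y s, _root_.pdz w x y s⟫_ℝ + ⟪_root_.pdz v x y s, w x y s⟫_ℝ)
    ((hv.continuous_inner hw).comp hc)
    (((hv.continuous_inner hw.pdz).comp hc).add ((hv.pdz.continuous_inner hw).comp hc))
    (fun s x => (hv.hasDerivAt_z x y s).inner ℝ (hw.hasDerivAt_z x y s)) 0 1 z
  rwa [intervalIntegral.integral_add (hv.intervalIntegrable_inner hw.pdz y z 0 1)
    (hv.pdz.intervalIntegrable_inner hw y z 0 1)] at h

lemma innerX_pdx (hv : Smooth3 v) (hw : Smooth3 w) (pv : PeriodicX v) (pw : PeriodicX w)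
    (y z : ℝ) : innerX (_root_.pdx v) w y z = -innerX v (_root_.pdx w) y z := by
  have i1 := hv.intervalIntegrable_inner hw.pdx y z 0 1
  have i2 := hv.pdx.intervalIntegrable_inner hw y z 0 1
  have h := intervalIntegral.integral_eq_sub_of_hasDerivAt (a := 0) (b := 1)
    (fun x _ => (hv.hasDerivAt_x x y z).inner ℝ (hw.hasDerivAt_x x y z)) (i1.add i2)
  have e1 := pv 0 y z
  have e2 := pw 0 y z
  rw [zero_add] at e1 e2
  rw [intervalIntegral.integral_add i1 i2, e1, e2, sub_self] at h
  simp only [innerX]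
  linarith

lemma lintegral_enorm_innerX_le (hv : Smooth3 v) (hw : Smooth3 w) :
    ∫⁻ q : ℝ × ℝ, ‖innerX v w q.1 q.2‖ₑ ∂(volume.prod (volume.restrict (Set.Ioc (0 : ℝ) 1)))
      ≤ eL2sq v + eL2sq w := by
  have h1 := hv.continuous.measurable
  have h2 := hw.continuous.measurable
  have h : eL2sq v + eL2sq w =
      ∫⁻ p, (‖v p.1 p.2.1 p.2.2‖ₑ ^ 2 + ‖w p.1 p.2.1 p.2.2‖ₑ ^ 2) ∂stripMeasure := by
    rw [lintegral_add_left (by fun_prop)]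
    rfl
  rw [h, stripMeasure, lintegral_prod_symm
    (fun p : ℝ × ℝ × ℝ => ‖v p.1 p.2.1 p.2.2‖ₑ ^ 2 + ‖w p.1 p.2.1 p.2.2‖ₑ ^ 2) (by fun_prop)]
  refine lintegral_mono fun q => ?_
  rw [innerX, intervalIntegral.integral_of_le zero_le_one]
  refine (enorm_integral_le_lintegral_enorm _).trans (lintegral_mono fun x => ?_)
  refine le_trans ?_ (ENNReal.mul_le_sq_add_sq _ _)
  rw [← ofReal_norm, ← ofReal_norm, ← ofReal_norm, ← ENNReal.ofReal_mul (norm_nonneg _)]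
  exact ENNReal.ofReal_le_ofReal (norm_inner_le_norm _ _)

lemma lintegral_sq_eq_innerX (hv : Smooth3 v) (y z : ℝ) :
    ∫⁻ x in Set.Ioc (0 : ℝ) 1, ‖v x y z‖ₑ ^ 2 = ‖innerX v v y z‖ₑ := by
  have hi := hv.intervalIntegrable_inner hv y z 0 1
  simp only [innerX, real_inner_self_eq_norm_sq] at hi ⊢
  rw [intervalIntegral.integral_of_le zero_le_one, Real.enorm_of_nonneg
    (integral_nonneg fun x => by positivity), ofReal_integral_eq_lintegral_ofReal
    ((intervalIntegrable_iff_integrableOn_Ioc_of_le zero_le_one).1 hi)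
    (Filter.Eventually.of_forall fun x => by positivity)]
  refine lintegral_congr fun x => ?_
  rw [ENNReal.ofReal_pow (norm_nonneg _), ofReal_norm]

lemma enorm_innerX_self_le (hv : Smooth3 v) {E : ℝ≥0∞} (h0 : eL2sq v ≤ E)
    (hy : eL2sq (_root_.pdy v) ≤ E) (hz : eL2sq (_root_.pdz v) ≤ E)
    (hyz : ∫⁻ q : ℝ × ℝ, ‖innerX v (_root_.pdz (_root_.pdy v)) q.1 q.2‖ₑ
      ∂(volume.prod (volume.restrict (Set.Ioc (0 : ℝ) 1))) ≤ 2 * E)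
    (y : ℝ) {z : ℝ} (hz1 : z ∈ Set.Ioc (0 : ℝ) 1) : ‖innerX v v y z‖ₑ ≤ 18 * E := by
  have cv := hv.continuous_innerX hv
  have cy := hv.continuous_innerX hv.pdy
  have cy' := hv.pdy.continuous_innerX hv
  have cz := hv.continuous_innerX hv.pdz
  have cz' := hv.pdz.continuous_innerX hv
  have cyz := hv.continuous_innerX hv.pdy.pdz
  have cyz' := hv.pdy.pdz.continuous_innerX hv
  have cm := hv.pdz.continuous_innerX hv.pdy
  have cm' := hv.pdy.continuous_innerX hv.pdz
  have h := enorm_le_lintegral_plane (φ := innerX v v)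
    (φy := fun y z => innerX v (_root_.pdy v) y z + innerX (_root_.pdy v) v y z)
    (φz := fun y z => innerX v (_root_.pdz v) y z + innerX (_root_.pdz v) v y z)
    (φyz := fun y z => innerX v (_root_.pdz (_root_.pdy v)) y z +
        innerX (_root_.pdz v) (_root_.pdy v) y z +
      (innerX (_root_.pdy v) (_root_.pdz v) y z +
        innerX (_root_.pdz (_root_.pdy v)) v y z))
    cv (cy.add cy') (cz.add cz') ((cyz.add cm).add (cm'.add cyz'))
    (fun y z => hv.hasDerivAt_innerX_y hv y z) (fun y z => hv.hasDerivAt_innerX_z hv y z)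
    (fun y z => (hv.hasDerivAt_innerX_z hv.pdy y z).add (hv.pdy.hasDerivAt_innerX_z hv y z))
    y hz1
  refine h.trans ?_
  have hb : ∀ {a b : ℝ → ℝ → ℝ → ℂ}, Smooth3 a → Smooth3 b → eL2sq a ≤ E → eL2sq b ≤ E →
      ∫⁻ q : ℝ × ℝ, ‖innerX a b q.1 q.2‖ₑ
        ∂(volume.prod (volume.restrict (Set.Ioc (0 : ℝ) 1))) ≤ 2 * E := fun ha hb ea eb =>
    (ha.lintegral_enorm_innerX_le hb).trans ((add_le_add ea eb).trans_eq (two_mul E).symm)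
  calc _ ≤ ∫⁻ q : ℝ × ℝ, (‖innerX v v q.1 q.2‖ₑ + (‖innerX v (_root_.pdz v) q.1 q.2‖ₑ +
        (‖innerX (_root_.pdz v) v q.1 q.2‖ₑ + (‖innerX v (_root_.pdy v) q.1 q.2‖ₑ +
        (‖innerX (_root_.pdy v) v q.1 q.2‖ₑ + (‖innerX v (_root_.pdz (_root_.pdy v)) q.1 q.2‖ₑ +
        (‖innerX (_root_.pdz v) (_root_.pdy v) q.1 q.2‖ₑ +
        (‖innerX (_root_.pdy v) (_root_.pdz v) q.1 q.2‖ₑ +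
        ‖innerX v (_root_.pdz (_root_.pdy v)) q.1 q.2‖ₑ))))))))
        ∂(volume.prod (volume.restrict (Set.Ioc (0 : ℝ) 1))) := by
        refine lintegral_mono fun q => ?_
        rw [innerX_comm (_root_.pdz (_root_.pdy v)) v]
        refine (add_le_add (add_le_add le_rfl (enorm_add_le _ _))
          (add_le_add (enorm_add_le _ _) ((enorm_add_le _ _).trans
            (add_le_add (enorm_add_le _ _) (enorm_add_le _ _))))).trans_eq ?_
        ring
    _ ≤ 2 * E + (2 * E + (2 * E + (2 * E + (2 * E + (2 * E + (2 * E + (2 * E + 2 * E))))))) := by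
        rw [lintegral_add_left cv.enorm.measurable, lintegral_add_left cz.enorm.measurable,
          lintegral_add_left cz'.enorm.measurable, lintegral_add_left cy.enorm.measurable,
          lintegral_add_left cy'.enorm.measurable, lintegral_add_left cyz.enorm.measurable,
          lintegral_add_left cm.enorm.measurable, lintegral_add_left cm'.enorm.measurable]
        gcongr
        exacts [hb hv hv h0 h0, hb hv hv.pdz h0 hz, hb hv.pdz hv hz h0, hb hv hv.pdy h0 hy,
          hb hv.pdy hv hy h0, hb hv.pdz hv.pdy hz hy, hb hv.pdy hv.pdz hy hz]
    _ = 18 * E := by ring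

end Smooth3

/-- The squared `H^N` norm, with values in `[0, ∞]`. -/
def eHNsq (N : ℕ) (f : ℝ → ℝ → ℝ → ℂ) : ℝ≥0∞ :=
  ∑ α ∈ multiIndicesLe N, eL2sq (pderiv3 α f)

lemma eL2sq_pderiv3_le (f : ℝ → ℝ → ℝ → ℂ) {N a b c : ℕ} (h : a + b + c ≤ N) :
    eL2sq (pderiv3 (a, b, c) f) ≤ eHNsq N f := by
  refine Finset.single_le_sum (f := fun α => eL2sq (pderiv3 α f)) (fun _ _ => zero_le) ?_
  simp only [multiIndicesLe, Finset.mem_filter, Finset.mem_product, Finset.mem_range]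
  omega

namespace Smooth3

variable {f g : ℝ → ℝ → ℝ → ℂ}

/-- The embedding `H² ⊂ L^∞` on the strip. -/
lemma sq_enorm_le (hf : Smooth3 f) (pf : PeriodicX f) {x z : ℝ} (hx : x ∈ Set.Ioc (0 : ℝ) 1)
    (y : ℝ) (hz : z ∈ Set.Ioc (0 : ℝ) 1) : ‖f x y z‖ₑ ^ 2 ≤ 54 * eHNsq 2 f := by
  have hf0 := hf.continuous_comp (continuous_id : Continuous fun t : ℝ => t)
    (continuous_const (y := y)) (continuous_const (y := z))
  have hf1 := hf.pdx.continuous_comp (continuous_id : Continuous fun t : ℝ => t)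
    (continuous_const (y := y)) (continuous_const (y := z))
  have key : ∀ a b c : ℕ, a + b + c ≤ 2 → eL2sq (_root_.pderiv3 (a, b, c) f) ≤ eHNsq 2 f :=
    fun a b c h => eL2sq_pderiv3_le f h
  have b0 : ‖innerX f f y z‖ₑ ≤ 18 * eHNsq 2 f :=
    hf.enorm_innerX_self_le (key 0 0 0 (by norm_num)) (key 0 1 0 (by norm_num))
      (key 0 0 1 (by norm_num))
      ((hf.lintegral_enorm_innerX_le hf.pdy.pdz).trans
        ((add_le_add (key 0 0 0 (by norm_num))
          (by rw [← hf.pdy_pdz]; exact key 0 1 1 (by norm_num))).trans_eq (two_mul _).symm)) y hz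
  have b1 : ‖innerX (_root_.pdx f) (_root_.pdx f) y z‖ₑ ≤ 18 * eHNsq 2 f := by
    refine hf.pdx.enorm_innerX_self_le (key 1 0 0 (by norm_num))
      (by rw [← hf.pdx_pdy]; exact key 1 1 0 (by norm_num))
      (by rw [← hf.pdx_pdz]; exact key 1 0 1 (by norm_num)) ?_ y hz
    rw [← hf.pdx_pdy, ← hf.pdy.pdx_pdz]
    have he : ∀ q : ℝ × ℝ, ‖innerX (_root_.pdx f) (_root_.pdx (_root_.pdz (_root_.pdy f))) q.1 q.2‖ₑ
        = ‖innerX (_root_.pdx (_root_.pdx f)) (_root_.pdz (_root_.pdy f)) q.1 q.2‖ₑ := fun q => by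
      rw [hf.pdx.innerX_pdx hf.pdy.pdz pf.pdx pf.pdy.pdz, enorm_neg]
    simp only [he]
    exact (hf.pdx.pdx.lintegral_enorm_innerX_le hf.pdy.pdz).trans
      ((add_le_add (key 2 0 0 (by norm_num))
        (by rw [← hf.pdy_pdz]; exact key 0 1 1 (by norm_num))).trans_eq (two_mul _).symm)
  have h := sq_enorm_le_lintegral_Ioc (v := fun t => f t y z)
    (v' := fun t => _root_.pdx f t y z) (fun t => hf.hasDerivAt_x t y z) hf1
    (a := 0) (t := x) (by simpa using ⟨hx.1.le, hx.2⟩)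
  rw [zero_add] at h
  calc ‖f x y z‖ₑ ^ 2 ≤ _ := h
    _ ≤ ∫⁻ t in Set.Ioc (0 : ℝ) 1, (2 * ‖f t y z‖ₑ ^ 2 + ‖_root_.pdx f t y z‖ₑ ^ 2) := by
        refine lintegral_mono fun t => ?_
        refine (add_le_add_right (enorm_mul_le_sq_add_sq _ _) _).trans_eq ?_
        ring
    _ = 2 * ‖innerX f f y z‖ₑ + ‖innerX (_root_.pdx f) (_root_.pdx f) y z‖ₑ := by
        have m := hf0.enorm.measurable
        rw [lintegral_add_left (by fun_prop), lintegral_const_mul _ (by fun_prop),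
          hf.lintegral_sq_eq_innerX, hf.pdx.lintegral_sq_eq_innerX]
    _ ≤ 2 * (18 * eHNsq 2 f) + 18 * eHNsq 2 f := by gcongr
    _ = _ := by ring

lemma eL2sq_mul_le_of_H2 (hg : Smooth3 g) (pg : PeriodicX g) (hf : Smooth3 f) :
    eL2sq (f * g) ≤ 54 * (eL2sq f * eHNsq 2 g) := by
  have h1 := hf.continuous.measurable
  calc eL2sq (f * g) ≤ ∫⁻ p, ‖f p.1 p.2.1 p.2.2‖ₑ ^ 2 * (54 * eHNsq 2 g) ∂stripMeasure := by
        refine lintegral_mono_ae ?_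
        filter_upwards [ae_stripMeasure_mem] with p hp
        simp only [Pi.mul_apply, enorm_mul, mul_pow]
        gcongr
        exact hg.sq_enorm_le pg hp.1 _ hp.2
    _ = _ := by
        rw [lintegral_mul_const _ (by fun_prop)]
        simp only [eL2sq]
        ring

end Smooth3

namespace Smooth3

variable {f g : ℝ → ℝ → ℝ → ℂ}

lemma pderiv3_add (hf : Smooth3 f) (hg : Smooth3 g) (α : ℕ × ℕ × ℕ) :
    _root_.pderiv3 α (f + g) = _root_.pderiv3 α f + _root_.pderiv3 α g := by
  have hz : ∀ n, _root_.pdz^[n] (f + g) = _root_.pdz^[n] f + _root_.pdz^[n] g := fun n => by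
    induction n with
    | zero => rfl
    | succ n ih =>
      simp only [Function.iterate_succ_apply']
      rw [ih, (hf.iterate_pdz n).pdz_add (hg.iterate_pdz n)]
  have hy : ∀ {u v : ℝ → ℝ → ℝ → ℂ}, Smooth3 u → Smooth3 v → ∀ n,
      _root_.pdy^[n] (u + v) = _root_.pdy^[n] u + _root_.pdy^[n] v := fun hu hv n => by
    induction n with
    | zero => rfl
    | succ n ih =>
      simp only [Function.iterate_succ_apply']
      rw [ih, (hu.iterate_pdy n).pdy_add (hv.iterate_pdy n)]
  have hx : ∀ {u v : ℝ → ℝ → ℝ → ℂ}, Smooth3 u → Smooth3 v → ∀ n,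
      _root_.pdx^[n] (u + v) = _root_.pdx^[n] u + _root_.pdx^[n] v := fun hu hv n => by
    induction n with
    | zero => rfl
    | succ n ih =>
      simp only [Function.iterate_succ_apply']
      rw [ih, (hu.iterate_pdx n).pdx_add (hv.iterate_pdx n)]
  simp only [_root_.pderiv3]
  rw [hz, hy (hf.iterate_pdz _) (hg.iterate_pdz _),
    hx ((hf.iterate_pdz _).iterate_pdy _) ((hg.iterate_pdz _).iterate_pdy _)]

lemma eL2sq_add_le (hf : Smooth3 f) (hg : Smooth3 g) :
    eL2sq (f + g) ≤ 2 * eL2sq f + 2 * eL2sq g := by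
  have h1 := hf.continuous.measurable
  have h2 := hg.continuous.measurable
  calc _ ≤ ∫⁻ p, (2 * ‖f p.1 p.2.1 p.2.2‖ₑ ^ 2 + 2 * ‖g p.1 p.2.1 p.2.2‖ₑ ^ 2)
        ∂stripMeasure := by
        refine lintegral_mono fun p => ?_
        exact (pow_le_pow_left₀ zero_le (enorm_add_le _ _) 2).trans (ENNReal.add_sq_le _ _)
    _ = _ := by
        rw [lintegral_add_left (by fun_prop), lintegral_const_mul _ (by fun_prop),
          lintegral_const_mul _ (by fun_prop)]
        rfl

/-- The `H¹` norm of a derivative is controlled by one more derivative. -/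
lemma eL2sq_grad_pderiv3_le (hf : Smooth3 f) {N a b c : ℕ} (h : a + b + c + 1 ≤ N) :
    eL2sq (_root_.pderiv3 (a, b, c) f) + eL2sq (_root_.pdx (_root_.pderiv3 (a, b, c) f))
      + eL2sq (_root_.pdy (_root_.pderiv3 (a, b, c) f))
      + eL2sq (_root_.pdz (_root_.pderiv3 (a, b, c) f)) ≤ 4 * eHNsq N f := by
  rw [pdx_pderiv3, hf.pdy_pderiv3, hf.pdz_pderiv3]
  calc _ ≤ eHNsq N f + eHNsq N f + eHNsq N f + eHNsq N f := by
        gcongr <;> exact eL2sq_pderiv3_le f (by omega)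
    _ = _ := by ring

lemma eHNsq_two_pderiv3_le (hf : Smooth3 f) {N a b c : ℕ} (h : a + b + c + 2 ≤ N) :
    eHNsq 2 (_root_.pderiv3 (a, b, c) f) ≤ 10 * eHNsq N f := by
  refine (Finset.sum_le_card_nsmul _ _ (eHNsq N f) fun α hα => ?_).trans_eq ?_
  · simp only [multiIndicesLe, Finset.mem_filter] at hα
    rw [show α = (α.1, α.2.1, α.2.2) from rfl, pderiv3_pderiv3 hf]
    exact eL2sq_pderiv3_le f (by omega)
  · rw [show (multiIndicesLe 2).card = 10 by decide, nsmul_eq_mul]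
    rfl

lemma eL2sq_pderiv3_mul_pderiv3_le (hf : Smooth3 f) (hg : Smooth3 g) (pg : PeriodicX g)
    {a b c a' b' c' : ℕ} (h : a + b + c + (a' + b' + c') ≤ 3) :
    eL2sq (_root_.pderiv3 (a, b, c) f * _root_.pderiv3 (a', b', c') g)
      ≤ 540 * (eHNsq 3 f * eHNsq 2 g + eHNsq 1 f * eHNsq 4 g) := by
  have e1 := (hg.pderiv3 (a', b', c')).eL2sq_mul_le_of_H2 (pg.pderiv3 (a', b', c'))
    (hf.pderiv3 (a, b, c))
  have e2 := (hf.pderiv3 (a, b, c)).eL2sq_mul_le (hg.pderiv3 (a', b', c'))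
  have c1 : (256 : ℝ≥0∞) ≤ 540 := by norm_num
  have c2 : (54 * 10 : ℝ≥0∞) = 540 := by norm_num
  by_cases h0 : a' + b' + c' = 0
  · refine e1.trans ?_
    have h1 := eL2sq_pderiv3_le f (N := 3) (a := a) (b := b) (c := c) (by omega)
    have h2 := hg.eHNsq_two_pderiv3_le (N := 2) (a := a') (b := b') (c := c') (by omega)
    calc _ ≤ 54 * (eHNsq 3 f * (10 * eHNsq 2 g)) := by gcongr
      _ = 540 * (eHNsq 3 f * eHNsq 2 g) := by rw [← c2]; ring
      _ ≤ _ := by gcongr; exact le_self_add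
  by_cases h1 : a + b + c = 0
  · refine e2.trans ?_
    have h1 := hf.eL2sq_grad_pderiv3_le (N := 1) (a := a) (b := b) (c := c) (by omega)
    have h2 := hg.eL2sq_grad_pderiv3_le (N := 4) (a := a') (b := b') (c := c') (by omega)
    calc _ ≤ 16 * ((4 * eHNsq 1 f) * (4 * eHNsq 4 g)) := by gcongr
      _ = 256 * (eHNsq 1 f * eHNsq 4 g) := by ring
      _ ≤ _ := by gcongr; exact le_add_self
  by_cases h2 : a + b + c = 1
  · refine e1.trans ?_
    have h1 := eL2sq_pderiv3_le f (N := 1) (a := a) (b := b) (c := c) (by omega)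
    have h2 := hg.eHNsq_two_pderiv3_le (N := 4) (a := a') (b := b') (c := c') (by omega)
    calc _ ≤ 54 * (eHNsq 1 f * (10 * eHNsq 4 g)) := by gcongr
      _ = 540 * (eHNsq 1 f * eHNsq 4 g) := by rw [← c2]; ring
      _ ≤ _ := by gcongr; exact le_add_self
  · refine e2.trans ?_
    have h1 := hf.eL2sq_grad_pderiv3_le (N := 3) (a := a) (b := b) (c := c) (by omega)
    have h2 := hg.eL2sq_grad_pderiv3_le (N := 2) (a := a') (b := b') (c := c') (by omega)
    calc _ ≤ 16 * ((4 * eHNsq 3 f) * (4 * eHNsq 2 g)) := by gcongr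
      _ = 256 * (eHNsq 3 f * eHNsq 2 g) := by ring
      _ ≤ _ := by gcongr; exact le_self_add

lemma eL2sq_pderiv3_add_le (hf : Smooth3 f) (hg : Smooth3 g) {α : ℕ × ℕ × ℕ} {n : ℕ} {K : ℝ≥0∞}
    (h1 : eL2sq (_root_.pderiv3 α f) ≤ 4 ^ n * K) (h2 : eL2sq (_root_.pderiv3 α g) ≤ 4 ^ n * K) :
    eL2sq (_root_.pderiv3 α (f + g)) ≤ 4 ^ (n + 1) * K := by
  rw [hf.pderiv3_add hg]
  calc _ ≤ 2 * (4 ^ n * K) + 2 * (4 ^ n * K) :=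
        ((hf.pderiv3 α).eL2sq_add_le (hg.pderiv3 α)).trans (by gcongr)
    _ = _ := by ring

lemma eL2sq_pderiv3_mul_le (hf : Smooth3 f) (hg : Smooth3 g) (pg : PeriodicX g)
    (n a b c a₁ b₁ c₁ a₂ b₂ c₂ : ℕ) (hn : a + b + c = n)
    (h : n + (a₁ + b₁ + c₁ + (a₂ + b₂ + c₂)) ≤ 3) :
    eL2sq (_root_.pderiv3 (a, b, c)
      (_root_.pderiv3 (a₁, b₁, c₁) f * _root_.pderiv3 (a₂, b₂, c₂) g))
      ≤ 4 ^ n * (540 * (eHNsq 3 f * eHNsq 2 g + eHNsq 1 f * eHNsq 4 g)) := by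
  induction n generalizing a b c a₁ b₁ c₁ a₂ b₂ c₂ with
  | zero =>
    obtain ⟨rfl, rfl, rfl⟩ : a = 0 ∧ b = 0 ∧ c = 0 := by omega
    rw [pow_zero, one_mul]
    exact hf.eL2sq_pderiv3_mul_pderiv3_le hg pg (by omega)
  | succ n ih =>
    have sf := hf.pderiv3
    have sg := hg.pderiv3
    match c, b, a, hn with
    | c + 1, b, a, hn =>
      have e : ∀ u, _root_.pderiv3 (a, b, c + 1) u = _root_.pderiv3 (a, b, c) (_root_.pdz u) :=
        fun _ => rfl
      rw [e, (sf _).pdz_mul (sg _), hf.pdz_pderiv3, hg.pdz_pderiv3]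
      exact ((sf _).mul (sg _)).eL2sq_pderiv3_add_le ((sf _).mul (sg _))
        (ih a b c _ _ _ _ _ _ (by omega) (by omega)) (ih a b c _ _ _ _ _ _ (by omega) (by omega))
    | 0, b + 1, a, hn =>
      have e : ∀ u, _root_.pderiv3 (a, b + 1, 0) u = _root_.pderiv3 (a, b, 0) (_root_.pdy u) :=
        fun _ => rfl
      rw [e, (sf _).pdy_mul (sg _), hf.pdy_pderiv3, hg.pdy_pderiv3]
      exact ((sf _).mul (sg _)).eL2sq_pderiv3_add_le ((sf _).mul (sg _))
        (ih a b 0 _ _ _ _ _ _ (by omega) (by omega)) (ih a b 0 _ _ _ _ _ _ (by omega) (by omega))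
    | 0, 0, a + 1, hn =>
      have e : ∀ u, _root_.pderiv3 (a + 1, 0, 0) u = _root_.pderiv3 (a, 0, 0) (_root_.pdx u) :=
        fun _ => rfl
      rw [e, (sf _).pdx_mul (sg _), pdx_pderiv3, pdx_pderiv3]
      exact ((sf _).mul (sg _)).eL2sq_pderiv3_add_le ((sf _).mul (sg _))
        (ih a 0 0 _ _ _ _ _ _ (by omega) (by omega)) (ih a 0 0 _ _ _ _ _ _ (by omega) (by omega))
    | 0, 0, 0, hn => omega

lemma eHNsq_three_mul_le (hf : Smooth3 f) (hg : Smooth3 g) (pg : PeriodicX g) :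
    eHNsq 3 (f * g) ≤ 691200 * (eHNsq 3 f * eHNsq 2 g + eHNsq 1 f * eHNsq 4 g) := by
  refine (Finset.sum_le_card_nsmul _ _
    (4 ^ 3 * (540 * (eHNsq 3 f * eHNsq 2 g + eHNsq 1 f * eHNsq 4 g))) fun α hα => ?_).trans_eq ?_
  · simp only [multiIndicesLe, Finset.mem_filter] at hα
    refine (hf.eL2sq_pderiv3_mul_le hg pg _ α.1 α.2.1 α.2.2 0 0 0 0 0 0 rfl (by omega)).trans ?_
    gcongr
    · norm_num
    · exact hα.2
  · rw [show (multiIndicesLe 3).card = 20 by decide, nsmul_eq_mul, ← mul_assoc, ← mul_assoc]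
    norm_num

lemma L2sq_eq_toReal (hf : Smooth3 f) (h : eL2sq f ≠ ∞) : L2sq f = (eL2sq f).toReal := by
  have hm := hf.continuous.measurable
  have hi : Integrable (fun p : ℝ × ℝ × ℝ => ‖f p.1 p.2.1 p.2.2‖ ^ 2) stripMeasure := by
    refine ⟨(hf.continuous.norm.pow 2).aestronglyMeasurable, ?_⟩
    rw [hasFiniteIntegral_iff_enorm]
    simp only [enorm_pow, enorm_norm]
    exact h.lt_top
  have h1 : L2sq f = ∫ p, ‖f p.1 p.2.1 p.2.2‖ ^ 2 ∂stripMeasure := by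
    rw [stripMeasure, integral_prod _ hi, L2sq]
    refine integral_congr_ae ?_
    filter_upwards [hi.prod_right_ae] with x hx
    exact (integral_prod _ hx).symm
  rw [h1, integral_eq_lintegral_of_nonneg_ae (Filter.Eventually.of_forall fun _ => by positivity)
    hi.1, eL2sq]
  congr 1
  refine lintegral_congr fun p => ?_
  rw [ENNReal.ofReal_pow (norm_nonneg _), ofReal_norm]

lemma HNsq_eq_toReal (hf : Smooth3 f) {N : ℕ} (h : eHNsq N f ≠ ∞) :
    HNsq N f = (eHNsq N f).toReal := by
  have h' := (ENNReal.sum_ne_top.1 h : ∀ α ∈ multiIndicesLe N, eL2sq (_root_.pderiv3 α f) ≠ ∞)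
  rw [eHNsq, ENNReal.toReal_sum h']
  exact Finset.sum_congr rfl fun α hα => (hf.pderiv3 α).L2sq_eq_toReal (h' α hα)

lemma eL2sq_ne_top (hf : Smooth3 f) {A B : ℝ} (hA : ∀ x y z, ‖f x y z‖ ≤ A)
    (hB : ∀ x y z, ‖f x y z‖ * |y| ≤ B) : eL2sq f ≠ ∞ := by
  have hi : Integrable (fun p : ℝ × ℝ × ℝ => (A ^ 2 + B ^ 2) * (1 + p.2.1 ^ 2)⁻¹)
      stripMeasure := by
    have h1 : Integrable (fun q : ℝ × ℝ => (A ^ 2 + B ^ 2) * (1 + q.1 ^ 2)⁻¹)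
        (volume.prod (volume.restrict (Set.Ioc (0 : ℝ) 1))) :=
      (integrable_inv_one_add_sq.comp_fst _).const_mul _
    exact h1.comp_snd _
  have h2 : Integrable (fun p : ℝ × ℝ × ℝ => ‖f p.1 p.2.1 p.2.2‖ ^ 2) stripMeasure := by
    refine hi.mono (hf.continuous.norm.pow 2).aestronglyMeasurable
      (Filter.Eventually.of_forall fun p => ?_)
    have hA' := pow_le_pow_left₀ (norm_nonneg _) (hA p.1 p.2.1 p.2.2) 2
    have hB' := pow_le_pow_left₀ (by positivity) (hB p.1 p.2.1 p.2.2) 2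
    rw [mul_pow, sq_abs] at hB'
    rw [Real.norm_of_nonneg (by positivity), Real.norm_of_nonneg (by positivity),
      ← div_eq_mul_inv, le_div_iff₀ (by positivity)]
    linarith
  have h3 := h2.2
  rw [hasFiniteIntegral_iff_enorm] at h3
  simp only [enorm_pow, enorm_norm] at h3
  exact h3.ne

end Smooth3

lemma GoodFn.eHNsq_ne_top {f : ℝ → ℝ → ℝ → ℂ} (hf : GoodFn f) (N : ℕ) : eHNsq N f ≠ ∞ := by
  refine ENNReal.sum_ne_top.2 fun α _ => ?_
  obtain ⟨A, hA⟩ := hf.decay α 0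
  obtain ⟨B, hB⟩ := hf.decay α 1
  exact (Smooth3.pderiv3 hf.smooth α).eL2sq_ne_top (A := A) (B := B)
    (by simpa using hA) (by simpa using hB)

lemma HNsq_three_mul_le {f g : ℝ → ℝ → ℝ → ℂ} (hf : GoodFn f) (hg : GoodFn g) :
    HNsq 3 (f * g) ≤ 691200 * (HNsq 3 f * HNsq 2 g + HNsq 1 f * HNsq 4 g) := by
  have sf : Smooth3 f := hf.smooth
  have sg : Smooth3 g := hg.smooth
  have h := sf.eHNsq_three_mul_le sg hg.per_x
  have ht : 691200 * (eHNsq 3 f * eHNsq 2 g + eHNsq 1 f * eHNsq 4 g) ≠ ∞ :=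
    ENNReal.mul_ne_top (by norm_num) (ENNReal.add_ne_top.2
      ⟨ENNReal.mul_ne_top (hf.eHNsq_ne_top 3) (hg.eHNsq_ne_top 2),
        ENNReal.mul_ne_top (hf.eHNsq_ne_top 1) (hg.eHNsq_ne_top 4)⟩)
  rw [(sf.mul sg).HNsq_eq_toReal (ne_top_of_le_ne_top ht h),
    sf.HNsq_eq_toReal (hf.eHNsq_ne_top 3), sf.HNsq_eq_toReal (hf.eHNsq_ne_top 1),
    sg.HNsq_eq_toReal (hg.eHNsq_ne_top 2), sg.HNsq_eq_toReal (hg.eHNsq_ne_top 4)]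
  refine (ENNReal.toReal_mono ht h).trans_eq ?_
  rw [ENNReal.toReal_mul, ENNReal.toReal_add
    (ENNReal.mul_ne_top (hf.eHNsq_ne_top 3) (hg.eHNsq_ne_top 2))
    (ENNReal.mul_ne_top (hf.eHNsq_ne_top 1) (hg.eHNsq_ne_top 4)), ENNReal.toReal_mul,
    ENNReal.toReal_mul]
  norm_num

lemma HNsq_nonneg (N : ℕ) (f : ℝ → ℝ → ℝ → ℂ) : 0 ≤ HNsq N f :=
  Finset.sum_nonneg fun _ _ => integral_nonneg fun _ => integral_nonneg fun _ =>
    integral_nonneg fun _ => by positivity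

/-- Product estimate: `‖f₁ f₂‖_{H³} ≤ C(‖f₁‖_{H³}‖f₂‖_{H²} + ‖f₁‖_{H¹}‖f₂‖_{H⁴})`. -/
theorem stmt18 : ∃ C : ℝ, 0 < C ∧ ∀ f₁ f₂ : ℝ → ℝ → ℝ → ℂ,
    GoodFn f₁ → GoodFn f₂ →
    HN 3 (fun x y z => f₁ x y z * f₂ x y z)
      ≤ C * (HN 3 f₁ * HN 2 f₂ + HN 1 f₁ * HN 4 f₂) := by
  refine ⟨Real.sqrt 691200, by positivity, fun f₁ f₂ h₁ h₂ => ?_⟩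
  have h : HNsq 3 (fun x y z => f₁ x y z * f₂ x y z)
      ≤ 691200 * (HNsq 3 f₁ * HNsq 2 f₂ + HNsq 1 f₁ * HNsq 4 f₂) := HNsq_three_mul_le h₁ h₂
  simp only [HN]
  refine (Real.sqrt_le_sqrt h).trans ?_
  rw [Real.sqrt_mul (by norm_num)]
  gcongr
  refine Real.sqrt_le_iff.2 ⟨by positivity, ?_⟩
  rw [← Real.sqrt_mul (HNsq_nonneg _ _), ← Real.sqrt_mul (HNsq_nonneg _ _)]
  have ha := Real.sq_sqrt (mul_nonneg (HNsq_nonneg 3 f₁) (HNsq_nonneg 2 f₂))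
  have hb := Real.sq_sqrt (mul_nonneg (HNsq_nonneg 1 f₁) (HNsq_nonneg 4 f₂))
  have hc := mul_nonneg (Real.sqrt_nonneg (HNsq 3 f₁ * HNsq 2 f₂))
    (Real.sqrt_nonneg (HNsq 1 f₁ * HNsq 4 f₂))
  nlinarith

end
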